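/- arXiv:nlin/0310038 — 3 statements merged into one kernel-verified Lean document; each statement's English description precedes it below -/
import Mathlib

section
/- Let τ, Φ : ℤ³ → ℂ and let T₁, T₂, T₃ denote the unit shift operators (Tᵢf)(n) = f(n + eᵢ) in the three lattice directions. Let c₁, c₂, c₃ ∈ ℂ. Suppose that for every Θ ∈ ℂ the function τ̃ = τ·(1 + ΘΦ) satisfies the Hirota-type addition formula c₁(T₁τ̃)(T₂T₃τ̃) + c₂(T₂τ̃)(T₁T₃τ̃) + c₃(T₃τ̃)(T₁T₂τ̃) = 0 at every lattice point, and suppose that at every lattice point the triple (c₁(T₁τ)(T₂T₃τ), c₂(T₂τ)(T₁T₃τ), c₃(T₃τ)(T₁T₂τ)) is not (0,0,0). Then at every lattice point Φ satisfies the determinant equation det [[1, 1, 1], [T₁Φ + T₂T₃Φ, T₂Φ + T₁T₃Φ, T₃Φ + T₁T₂Φ], [(T₁Φ)(T₂T₃Φ), (T₂Φ)(T₁T₃Φ), (T₃Φ)(T₁T₂Φ)]] = 0. -/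
open Matrix

/-- The unit shift operator in the `i`-th lattice direction:
`(Tᵢ f)(n) = f(n + eᵢ)` for functions on the lattice `ℤ³`. -/
def latticeShift (i : Fin 3) (f : (Fin 3 → ℤ) → ℂ) : (Fin 3 → ℤ) → ℂ :=
  fun n => f (n + Pi.single i 1)

/-- If `τ̃ = τ·(1 + ΘΦ)` satisfies the trilinear Hirota addition formula for every `Θ ∈ ℂ`,
and the triple of products built from `τ` is nowhere `(0,0,0)`, then `Φ` satisfies the
determinant form of the discrete Schwarzian KP equation at every lattice point. -/
theorem discrete_SKP_det (τ Φ : (Fin 3 → ℤ) → ℂ) (c₁ c₂ c₃ : ℂ)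
    (T₁ T₂ T₃ : ((Fin 3 → ℤ) → ℂ) → (Fin 3 → ℤ) → ℂ)
    (hT₁ : T₁ = latticeShift 0) (hT₂ : T₂ = latticeShift 1) (hT₃ : T₃ = latticeShift 2)
    (hhirota : ∀ Θ : ℂ, ∀ n : Fin 3 → ℤ,
      c₁ * T₁ (fun m => τ m * (1 + Θ * Φ m)) n * T₂ (T₃ (fun m => τ m * (1 + Θ * Φ m))) n
        + c₂ * T₂ (fun m => τ m * (1 + Θ * Φ m)) n * T₁ (T₃ (fun m => τ m * (1 + Θ * Φ m))) n
        + c₃ * T₃ (fun m => τ m * (1 + Θ * Φ m)) n * T₁ (T₂ (fun m => τ m * (1 + Θ * Φ m))) n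
        = 0)
    (hnd : ∀ n : Fin 3 → ℤ,
      ¬(c₁ * T₁ τ n * T₂ (T₃ τ) n = 0 ∧ c₂ * T₂ τ n * T₁ (T₃ τ) n = 0
          ∧ c₃ * T₃ τ n * T₁ (T₂ τ) n = 0)) :
    ∀ n : Fin 3 → ℤ,
      det !![(1 : ℂ), 1, 1;
             T₁ Φ n + T₂ (T₃ Φ) n, T₂ Φ n + T₁ (T₃ Φ) n, T₃ Φ n + T₁ (T₂ Φ) n;
             T₁ Φ n * T₂ (T₃ Φ) n, T₂ Φ n * T₁ (T₃ Φ) n, T₃ Φ n * T₁ (T₂ Φ) n] = 0 := by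
  intro n
  have h0 := hhirota 0 n
  have h1 := hhirota 1 n
  have h2 := hhirota (-1) n
  have hn := hnd n
  subst hT₁ hT₂ hT₃
  simp only [latticeShift] at h0 h1 h2 hn ⊢
  refine exists_mulVec_eq_zero_iff.mp
    ⟨![c₁ * τ (n + Pi.single 0 1) * τ (n + Pi.single 1 1 + Pi.single 2 1),
       c₂ * τ (n + Pi.single 1 1) * τ (n + Pi.single 0 1 + Pi.single 2 1),
       c₃ * τ (n + Pi.single 2 1) * τ (n + Pi.single 0 1 + Pi.single 1 1)], fun hv => hn ?_, ?_⟩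
  · exact ⟨congrFun hv 0, congrFun hv 1, congrFun hv 2⟩
  · ext i
    fin_cases i <;> simp [mulVec, dotProduct, Fin.sum_univ_three]
    · linear_combination h0
    · linear_combination (h1 - h2) / 2
    · linear_combination (h1 + h2) / 2 - h0
end

section
/- Let R be a commutative ring, let φ₁, φ₂, φ₃, φ₁₂, φ₁₃, φ₂₃, u, v ∈ R, and set ψᵢ = u·φᵢ for i = 1, 2, 3 and ψᵢⱼ = v·φᵢφⱼ + u·φᵢⱼ for the pairs (1,2), (1,3), (2,3). Then det [[1, 1, 1], [ψ₂ψ₃, ψ₁ψ₃, ψ₁ψ₂], [ψ₂₃, ψ₁₃, ψ₁₂]] = u³ · det [[1, 1, 1], [φ₂φ₃, φ₁φ₃, φ₁φ₂], [φ₂₃, φ₁₃, φ₁₂]]. In particular, if u is invertible (or R has no zero divisors and u ≠ 0), the first determinant vanishes if and only if the second does. -/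
open Matrix

/-- Conformal (Möbius) invariance of the dispersionless Schwarzian KP determinant
equation: under the substitution `ψᵢ = u·φᵢ`, `ψᵢⱼ = v·φᵢφⱼ + u·φᵢⱼ` (coming from
`φ ↦ f(φ)` with `u = f'(φ)`, `v = f''(φ)`), the determinant is multiplied by `u³`;
in particular, if `u` is invertible, the determinant vanishes iff the original one does. -/
theorem dSKP_conformal_invariance {R : Type*} [CommRing R]
    (φ₁ φ₂ φ₃ φ₁₂ φ₁₃ φ₂₃ u v : R) (ψ₁ ψ₂ ψ₃ ψ₁₂ ψ₁₃ ψ₂₃ : R)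
    (hψ₁ : ψ₁ = u * φ₁) (hψ₂ : ψ₂ = u * φ₂) (hψ₃ : ψ₃ = u * φ₃)
    (hψ₁₂ : ψ₁₂ = v * (φ₁ * φ₂) + u * φ₁₂)
    (hψ₁₃ : ψ₁₃ = v * (φ₁ * φ₃) + u * φ₁₃)
    (hψ₂₃ : ψ₂₃ = v * (φ₂ * φ₃) + u * φ₂₃) :
    det !![(1 : R), 1, 1;
           ψ₂ * ψ₃, ψ₁ * ψ₃, ψ₁ * ψ₂;
           ψ₂₃, ψ₁₃, ψ₁₂]
      = u ^ 3 * det !![(1 : R), 1, 1;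
                       φ₂ * φ₃, φ₁ * φ₃, φ₁ * φ₂;
                       φ₂₃, φ₁₃, φ₁₂] ∧
    (IsUnit u →
      (det !![(1 : R), 1, 1;
              ψ₂ * ψ₃, ψ₁ * ψ₃, ψ₁ * ψ₂;
              ψ₂₃, ψ₁₃, ψ₁₂] = 0 ↔
        det !![(1 : R), 1, 1;
               φ₂ * φ₃, φ₁ * φ₃, φ₁ * φ₂;
               φ₂₃, φ₁₃, φ₁₂] = 0)) := by
  have det_eq : det !![(1 : R), 1, 1;
           ψ₂ * ψ₃, ψ₁ * ψ₃, ψ₁ * ψ₂;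
           ψ₂₃, ψ₁₃, ψ₁₂]
      = u ^ 3 * det !![(1 : R), 1, 1;
                       φ₂ * φ₃, φ₁ * φ₃, φ₁ * φ₂;
                       φ₂₃, φ₁₃, φ₁₂] := by
    subst hψ₁ hψ₂ hψ₃ hψ₁₂ hψ₁₃ hψ₂₃
    simp [det_fin_three]
    ring
  exact ⟨det_eq, fun hu => by rw [det_eq, (hu.pow 3).mul_right_eq_zero]⟩
end

section
/- Let A be a commutative ring (or algebra) and let P, M, T be pairwise commuting derivations of A (modeling D₊, D₋, ∂ₜ of the dispersionless 2D Toda hierarchy). For φ ∈ A, define D₁ = P, D₂ = M + T, D₃ = T, and let φᵢ = Dᵢφ, φᵢⱼ = DᵢDⱼφ. Then det [[1, 1, 1], [φ₂φ₃, φ₁φ₃, φ₁φ₂], [φ₂₃, φ₁₃, φ₁₂]] = (Pφ)(Mφ)·(T²φ + TMφ − TPφ) − (Tφ)(PMφ)·(Tφ + Mφ − Pφ). In particular, the determinant equation det = 0 holds if and only if φ satisfies the conformally invariant dispersionless 2D Toda generating equation (∂ₜφ)(D₊D₋φ)(∂ₜ + D₋ − D₊)φ = (D₊φ)(D₋φ)∂ₜ(∂ₜ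 + D₋ − D₊)φ. -/
open Matrix

/-- For pairwise commuting derivations `P = D₊`, `M = D₋`, `T = ∂ₜ` of a commutative
ring, with `D₁ = P`, `D₂ = M + T`, `D₃ = T`, the dispersionless Schwarzian KP
determinant built from `φᵢ = Dᵢφ`, `φᵢⱼ = DᵢDⱼφ` equals
`(Pφ)(Mφ)(T²φ + TMφ − TPφ) − (Tφ)(PMφ)(Tφ + Mφ − Pφ)`; in particular the determinant
equation holds iff `φ` satisfies the conformally invariant dispersionless 2D Toda
generating equation `(∂ₜφ)(D₊D₋φ)(∂ₜ + D₋ − D₊)φ = (D₊φ)(D₋φ)∂ₜ(∂ₜ + D₋ − D₊)φ`. -/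
theorem dToda_conformal_det {A : Type*} [CommRing A] (P M T : Derivation ℤ A A)
    (hPM : ∀ a : A, P (M a) = M (P a)) (hPT : ∀ a : A, P (T a) = T (P a))
    (hMT : ∀ a : A, M (T a) = T (M a))
    (φ : A) (D₁ D₂ D₃ : A → A)
    (hD₁ : D₁ = fun a => P a) (hD₂ : D₂ = fun a => M a + T a) (hD₃ : D₃ = fun a => T a) :
    det !![(1 : A), 1, 1;
           D₂ φ * D₃ φ, D₁ φ * D₃ φ, D₁ φ * D₂ φ;
           D₂ (D₃ φ), D₁ (D₃ φ), D₁ (D₂ φ)]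
      = P φ * M φ * (T (T φ) + T (M φ) - T (P φ))
          - T φ * P (M φ) * (T φ + M φ - P φ) ∧
    (det !![(1 : A), 1, 1;
            D₂ φ * D₃ φ, D₁ φ * D₃ φ, D₁ φ * D₂ φ;
            D₂ (D₃ φ), D₁ (D₃ φ), D₁ (D₂ φ)] = 0 ↔
      T φ * P (M φ) * (T φ + M φ - P φ)
        = P φ * M φ * T (T φ + M φ - P φ)) := by
  subst hD₁ hD₂ hD₃
  have key : det !![(1 : A), 1, 1;
      (M φ + T φ) * T φ, P φ * T φ, P φ * (M φ + T φ);
      M (T φ) + T (T φ), P (T φ), P (M φ + T φ)]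
      = P φ * M φ * (T (T φ) + T (M φ) - T (P φ))
          - T φ * P (M φ) * (T φ + M φ - P φ) := by
    simp only [det_fin_three, of_apply, cons_val, map_add, hPT, hMT]
    ring
  refine ⟨key, ?_⟩
  rw [key, sub_eq_zero, map_sub, map_add]
  exact eq_comm
end
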